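/- Proposition (Proposition 2.6(2)). Let K ⊆ {1, …, n} and assume P is nondegenerate. If P is a flag polytope, then the full-dimensional polytope P ∩ C_K is a flag polytope. -/

import Mathlib

open scoped RealInnerProductSpace

noncomputable section

variable {V : Type*} [NormedAddCommGroup V] [InnerProductSpace ℝ V]

/-- The reflection `r_α` across the hyperplane orthogonal to `α`:
`r_α(x) = x − (2⟪x,α⟫/⟪α,α⟫) α`. -/
def reflMap (α : V) : V → V := fun x => x - (2 * ⟪x, α⟫ / ⟪α, α⟫) • α

/-- The hyperplane `H_α = {x | ⟪x, α⟫ = 0}` fixed by `reflMap α`. -/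
def hplane (α : V) : Set V := {x : V | ⟪x, α⟫ = 0}

/-- `F` is a facet of the full-dimensional polytope `Q`: an exposed face whose affine
span has dimension `n − 1` (where `n = dim V`). -/
def IsFacet (Q F : Set V) : Prop :=
  IsExposed ℝ Q F ∧ Module.finrank ℝ (affineSpan ℝ F).direction + 1 = Module.finrank ℝ V

open Classical in
/-- The barycenter of a nonempty face: the centroid of its finitely many extreme points. -/
def barycenter (F : Set V) : V :=
  if h : (Set.extremePoints ℝ F).Finite then h.toFinset.centroid ℝ id else 0

/-- A full-dimensional polytope is simple if every extreme point lies in exactly `n` facets. -/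
def IsSimple (Q : Set V) : Prop :=
  ∀ v ∈ Set.extremePoints ℝ Q, {F : Set V | IsFacet Q F ∧ v ∈ F}.ncard = Module.finrank ℝ V

/-- The cone `C_K = {x | ⟪x, α_k⟫ ≥ 0 for all k ∈ K}`. -/
def cham {n : ℕ} (α : Fin n → V) (K : Set (Fin n)) : Set V :=
  {x : V | ∀ k ∈ K, 0 ≤ ⟪x, α k⟫}

/-- The parabolic subgroup `W_K`, realized as the submonoid of `Function.End V`
generated by the simple reflections `r_{α_k}`, `k ∈ K` (since each generator is an
involution, this submonoid coincides with the generated group). -/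
def WK {n : ℕ} (α : Fin n → V) (K : Set (Fin n)) : Submonoid (Function.End V) :=
  Submonoid.closure {g : Function.End V | ∃ k ∈ K, g = reflMap (α k)}

/-- A reduced root system of full rank `n` in `V` with a fixed simple system `α`. -/
structure RootSystemData (V : Type*) [NormedAddCommGroup V] [InnerProductSpace ℝ V]
    (n : ℕ) : Type _ where
  α : Fin n → V
  R : Set V
  hn : 1 ≤ n
  hdim : Module.finrank ℝ V = n
  hR_fin : R.Finite
  hR_ne0 : ∀ β ∈ R, β ≠ 0
  hR_refl : ∀ β ∈ R, reflMap β '' R = R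
  hR_red : ∀ β ∈ R, R ∩ {x : V | ∃ c : ℝ, x = c • β} = {β, -β}
  hα_mem : ∀ i, α i ∈ R
  hα_indep : LinearIndependent ℝ α
  hα_span : Submodule.span ℝ (Set.range α) = ⊤
  hα_sign : ∀ β ∈ R, ∃ c : Fin n → ℝ, β = ∑ i, c i • α i ∧
    ((∀ i, 0 ≤ c i) ∨ (∀ i, c i ≤ 0))

/-- A `W`-symmetric polytope datum: a root system together with a finite nonempty
set `Λ` contained in the fundamental chamber `C_S`. -/
structure PermSetup (V : Type*) [NormedAddCommGroup V] [InnerProductSpace ℝ V]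
    (n : ℕ) extends RootSystemData V n where
  Λ : Set V
  hΛ_fin : Λ.Finite
  hΛ_ne : Λ.Nonempty
  hΛ_cham : Λ ⊆ cham α Set.univ

/-- The `W`-symmetric polytope `P = conv(⋃_{w ∈ W} w(Λ))`. -/
def PermSetup.P {n : ℕ} (S : PermSetup V n) : Set V :=
  convexHull ℝ (⋃ w ∈ WK S.α Set.univ, Set.image w S.Λ)

/-- `P` is nondegenerate: `⟪λ, α_i⟫ > 0` for every `λ ∈ Λ` and every `i`. -/
def PermSetup.Nondegenerate {n : ℕ} (S : PermSetup V n) : Prop :=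
  ∀ l ∈ S.Λ, ∀ i, 0 < ⟪l, S.α i⟫

/-- A full-dimensional polytope `Q` is flag if every nonempty collection of facets,
any two of which intersect, has nonempty total intersection. -/
def IsFlag {V : Type*} [NormedAddCommGroup V] [InnerProductSpace ℝ V] (Q : Set V) : Prop :=
  ∀ 𝒢 : Set (Set V), 𝒢.Nonempty → (∀ F ∈ 𝒢, IsFacet Q F) →
    (∀ F ∈ 𝒢, ∀ F' ∈ 𝒢, (F ∩ F').Nonempty) → (⋂₀ 𝒢).Nonempty

theorem inner_reflMap (α x y : V) : ⟪reflMap α x, y⟫ = ⟪x, reflMap α y⟫ := by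
  simp only [reflMap, inner_sub_left, inner_sub_right, real_inner_smul_left,
    real_inner_smul_right, real_inner_comm y α]
  ring

theorem isLinearMap_reflMap (α : V) : IsLinearMap ℝ (reflMap α) where
  map_add x y := by
    simp only [reflMap, inner_add_left, mul_add, add_div, add_smul]
    abel
  map_smul c x := by
    simp only [reflMap, real_inner_smul_left, smul_sub, smul_smul]
    congr 2
    ring

namespace RootSystemData

variable {n : ℕ} (D : RootSystemData V n)

theorem α_ne_zero (i : Fin n) : D.α i ≠ 0 := D.hR_ne0 _ (D.hα_mem i)

theorem inner_α_self_pos (i : Fin n) : 0 < ⟪D.α i, D.α i⟫ :=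
  real_inner_self_pos.2 (D.α_ne_zero i)

theorem reflMap_mem {β γ : V} (hβ : β ∈ D.R) (hγ : γ ∈ D.R) : reflMap β γ ∈ D.R := by
  rw [← D.hR_refl β hβ]
  exact Set.mem_image_of_mem _ hγ

/-- Distinct simple roots form a non-acute angle. -/
theorem inner_α_nonpos {i j : Fin n} (hij : i ≠ j) : ⟪D.α i, D.α j⟫ ≤ 0 := by
  obtain ⟨c, hc, hs⟩ := D.hα_sign _ (D.reflMap_mem (D.hα_mem j) (D.hα_mem i))
  have hpos := D.inner_α_self_pos j
  set d := 2 * ⟪D.α i, D.α j⟫ / ⟪D.α j, D.α j⟫ with hd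
  have hsum : ∑ k, (c k - ((if k = i then 1 else 0) - if k = j then d else 0)) • D.α k = 0 := by
    simp only [sub_smul, Finset.sum_sub_distrib, ite_smul, one_smul, zero_smul,
      Finset.sum_ite_eq', Finset.mem_univ, if_true]
    rw [← hc]
    simp [reflMap, hd]
  have hz := Fintype.linearIndependent_iff.1 D.hα_indep _ hsum
  have hi := hz i
  have hj := hz j
  simp only [if_true, if_neg hij, if_neg hij.symm] at hi hj
  rcases hs with hs | hs
  · have : d ≤ 0 := by linarith [hs j]
    rw [hd, div_le_iff₀ hpos] at this
    linarith
  · linarith [hs i]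

/-- Elements of `W` are adjoint to permutations of the roots. -/
theorem exists_root_inner_eq {w : Function.End V} (hw : w ∈ WK D.α Set.univ) :
    ∀ β ∈ D.R, ∃ γ ∈ D.R, ∀ x, ⟪w x, β⟫ = ⟪x, γ⟫ := by
  induction hw using Submonoid.closure_induction with
  | mem g hg =>
    obtain ⟨k, -, rfl⟩ := hg
    exact fun β hβ => ⟨_, D.reflMap_mem (D.hα_mem k) hβ, fun x => inner_reflMap _ _ _⟩
  | one => exact fun β hβ => ⟨β, hβ, fun x => rfl⟩
  | mul g h _ _ ihg ihh =>
    intro β hβ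
    obtain ⟨γ, hγ, h1⟩ := ihg β hβ
    obtain ⟨δ, hδ, h2⟩ := ihh γ hγ
    exact ⟨δ, hδ, fun x => (h1 (h x)).trans (h2 x)⟩

theorem inner_root_ne_zero {x : V} (hx : ∀ i, 0 < ⟪x, D.α i⟫) {β : V} (hβ : β ∈ D.R) :
    ⟪x, β⟫ ≠ 0 := by
  obtain ⟨c, rfl, hs⟩ := D.hα_sign β hβ
  intro h0
  apply D.hR_ne0 _ hβ
  simp only [inner_sum, real_inner_smul_right] at h0
  have hc : ∀ i, c i = 0 := by
    intro i
    rcases hs with hs | hs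
    · have := (Finset.sum_eq_zero_iff_of_nonneg
        (fun i _ => mul_nonneg (hs i) (hx i).le)).1 h0 i (Finset.mem_univ i)
      exact (mul_eq_zero.1 this).resolve_right (hx i).ne'
    · have := (Finset.sum_eq_zero_iff_of_nonpos
        (fun i _ => mul_nonpos_of_nonpos_of_nonneg (hs i) (hx i).le)).1 h0 i (Finset.mem_univ i)
      exact (mul_eq_zero.1 this).resolve_right (hx i).ne'
  simp [hc]

end RootSystemData

namespace PermSetup

variable {n : ℕ} (S : PermSetup V n)

/-- The union of the `W`-orbits of the points of `Λ`. -/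
def orbit : Set V := ⋃ w ∈ WK S.α Set.univ, Set.image w S.Λ

theorem mem_orbit {x : V} : x ∈ S.orbit ↔ ∃ w ∈ WK S.α Set.univ, ∃ l ∈ S.Λ, w l = x := by
  simp only [orbit, Set.mem_iUnion, exists_prop]
  rfl

theorem finite_orbit : S.orbit.Finite := by
  have hfin : (Set.image2 (fun l γ => ⟪l, γ⟫) S.Λ S.R).Finite := S.hΛ_fin.image2 _ S.hR_fin
  refine Set.Finite.of_finite_image (f := fun x i => ⟪x, S.α i⟫)
    ((Set.Finite.pi' fun _ : Fin n => hfin).subset ?_) ?_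
  · rintro _ ⟨x, hx, rfl⟩ i
    obtain ⟨w, hw, l, hl, rfl⟩ := S.mem_orbit.1 hx
    obtain ⟨γ, hγ, h⟩ := S.exists_root_inner_eq hw _ (S.hα_mem i)
    exact ⟨l, hl, γ, hγ, (h l).symm⟩
  · intro x _ y _ hxy
    rw [← sub_eq_zero, ← Submodule.mem_bot ℝ, ← Submodule.top_orthogonal_eq_bot, ← S.hα_span,
      Submodule.mem_orthogonal]
    intro u hu
    induction hu using Submodule.span_induction with
    | mem u hu =>
      obtain ⟨i, rfl⟩ := hu
      rw [real_inner_comm, inner_sub_left, sub_eq_zero]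
      exact congrFun hxy i
    | zero => simp
    | add u v _ _ hu hv => rw [inner_add_left, hu, hv, add_zero]
    | smul c u _ hu => rw [real_inner_smul_left, hu, mul_zero]

theorem isCompact_P : IsCompact S.P := S.finite_orbit.isCompact_convexHull ℝ

theorem convex_P : Convex ℝ S.P := convex_convexHull ℝ _

theorem subset_P : S.Λ ⊆ S.P := fun l hl =>
  subset_convexHull ℝ _ (S.mem_orbit.2 ⟨1, one_mem _, l, hl, rfl⟩)

theorem reflMap_mem_P {x : V} (hx : x ∈ S.P) (i : Fin n) : reflMap (S.α i) x ∈ S.P := by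
  suffices h : S.P ⊆ reflMap (S.α i) ⁻¹' S.P from h hx
  refine convexHull_min ?_ (S.convex_P.is_linear_preimage (isLinearMap_reflMap _))
  intro y hy
  obtain ⟨w, hw, l, hl, rfl⟩ := S.mem_orbit.1 hy
  let r : Function.End V := reflMap (S.α i)
  exact subset_convexHull ℝ _ (S.mem_orbit.2 ⟨r * w,
    mul_mem (Submonoid.subset_closure ⟨i, trivial, rfl⟩) hw, l, hl, rfl⟩)

theorem inner_orbit_ne_zero (hnd : S.Nondegenerate) {x : V} (hx : x ∈ S.orbit) (i : Fin n) :
    ⟪x, S.α i⟫ ≠ 0 := by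
  obtain ⟨w, hw, l, hl, rfl⟩ := S.mem_orbit.1 hx
  obtain ⟨γ, hγ, h⟩ := S.exists_root_inner_eq hw _ (S.hα_mem i)
  rw [h]
  exact S.inner_root_ne_zero (hnd l hl) hγ

/-- A maximizer of `f` over `P` lies weakly on the same side of `H_{α_i}` as `f`. -/
theorem inner_mul_nonneg_of_isMaxOn {f : V →L[ℝ] ℝ} {x : V} (hx : x ∈ S.P)
    (hmax : ∀ y ∈ S.P, f y ≤ f x) (i : Fin n) : 0 ≤ ⟪x, S.α i⟫ * f (S.α i) := by
  have h := hmax _ (S.reflMap_mem_P hx i)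
  have hpos := S.inner_α_self_pos i
  simp only [reflMap, map_sub, map_smul, smul_eq_mul] at h
  have h2 : 0 ≤ 2 * (⟪x, S.α i⟫ * f (S.α i)) / ⟪S.α i, S.α i⟫ := by
    rw [show 2 * (⟪x, S.α i⟫ * f (S.α i)) / ⟪S.α i, S.α i⟫ =
      2 * ⟪x, S.α i⟫ / ⟪S.α i, S.α i⟫ * f (S.α i) by ring]
    linarith
  rw [le_div_iff₀ hpos] at h2
  linarith

theorem convex_lex {f g : V →ₗ[ℝ] ℝ} (M : ℝ) :
    Convex ℝ {z : V | f z < M ∨ f z = M ∧ 0 < g z} := by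
  intro x hx y hy a b ha hb hab
  obtain rfl | ha := ha.eq_or_lt
  · obtain rfl : b = 1 := by linarith
    simpa using hy
  obtain rfl | hb := hb.eq_or_lt
  · obtain rfl : a = 1 := by linarith
    simpa using hx
  obtain rfl : b = 1 - a := by linarith
  simp only [Set.mem_ofPred_eq, map_add, map_smul, smul_eq_mul] at hx hy ⊢
  rcases hx with hx | ⟨hx, hx'⟩ <;> rcases hy with hy | ⟨hy, hy'⟩
  · left; nlinarith
  · left; nlinarith
  · left; nlinarith
  · right
    refine ⟨by rw [hx, hy]; ring, by positivity⟩

/-- In the nondegenerate case, a functional whose maximal face on `P` meets `H_{α_i}`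
vanishes on `α_i`. -/
theorem apply_α_eq_zero_of_isMaxOn (hnd : S.Nondegenerate) {f : V →L[ℝ] ℝ} {x : V}
    (hx : x ∈ S.P) (hmax : ∀ y ∈ S.P, f y ≤ f x) {i : Fin n} (hxi : ⟪x, S.α i⟫ = 0) :
    f (S.α i) = 0 := by
  by_contra h0
  have key : S.P ⊆ {z : V | f.toLinearMap z < f x ∨ f.toLinearMap z = f x ∧
      0 < (f (S.α i) • (innerSL ℝ (S.α i)).toLinearMap) z} := by
    refine convexHull_min ?_ (convex_lex _)
    intro z hz
    have hzP : z ∈ S.P := subset_convexHull ℝ _ hz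
    rcases (hmax z hzP).lt_or_eq with h | h
    · exact Or.inl h
    · refine Or.inr ⟨h, ?_⟩
      have h1 := S.inner_mul_nonneg_of_isMaxOn hzP (fun y hy => h ▸ hmax y hy) i
      have h2 := mul_ne_zero (S.inner_orbit_ne_zero hnd hz i) h0
      have h3 := lt_of_le_of_ne h1 h2.symm
      simpa [real_inner_comm, mul_comm] using h3
  rcases key hx with h | ⟨-, h⟩
  · exact lt_irrefl _ h
  · simp [real_inner_comm, hxi] at h

/-- A functional whose maximal face on `P` meets `C_K` lies in the dual description of `C_K`. -/
theorem apply_α_nonneg_of_isMaxOn (hnd : S.Nondegenerate) {f : V →L[ℝ] ℝ} {x : V}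
    (hx : x ∈ S.P) (hmax : ∀ y ∈ S.P, f y ≤ f x) {i : Fin n} (hxi : 0 ≤ ⟪x, S.α i⟫) :
    0 ≤ f (S.α i) := by
  rcases hxi.eq_or_lt with h | h
  · exact (S.apply_α_eq_zero_of_isMaxOn hnd hx hmax h.symm).ge
  · exact nonneg_of_mul_nonneg_right (S.inner_mul_nonneg_of_isMaxOn hx hmax i) h

theorem interior_inter_cham_nonempty (hfull : (interior S.P).Nonempty)
    (hnd : S.Nondegenerate) (K : Set (Fin n)) :
    (interior (S.P ∩ cham S.α K)).Nonempty := by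
  obtain ⟨l, hl⟩ := S.hΛ_ne
  have hU : IsOpen {x : V | ∀ i, 0 < ⟪x, S.α i⟫} := by
    simp only [Set.ofPred_forall]
    exact isOpen_iInter_of_finite fun i => isOpen_lt continuous_const (by fun_prop)
  have hcl : l ∈ closure (interior S.P) := by
    rw [S.convex_P.closure_interior_eq_closure_of_nonempty_interior hfull]
    exact subset_closure (S.subset_P hl)
  obtain ⟨x, hxU, hxP⟩ := mem_closure_iff.1 hcl _ hU (hnd l hl)
  exact ⟨x, mem_interior.2 ⟨_, fun y hy => ⟨interior_subset hy.1, fun k _ => (hy.2 k).le⟩,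
    isOpen_interior.inter hU, hxP, hxU⟩⟩

end PermSetup

theorem vectorSpan_le_ker {f : V →ₗ[ℝ] ℝ} {A : Set V} {c : ℝ} (h : ∀ x ∈ A, f x = c) :
    vectorSpan ℝ A ≤ LinearMap.ker f := by
  refine Submodule.span_le.2 ?_
  rintro _ ⟨x, hx, y, hy, rfl⟩
  simp [h x hx, h y hy]

theorem convex_cham {n : ℕ} (α : Fin n → V) (K : Set (Fin n)) : Convex ℝ (cham α K) := by
  intro x hx y hy a b ha hb _ k hk
  rw [inner_add_left, real_inner_smul_left, real_inner_smul_left]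
  exact add_nonneg (mul_nonneg ha (hx k hk)) (mul_nonneg hb (hy k hk))

theorem isClosed_cham {n : ℕ} (α : Fin n → V) (K : Set (Fin n)) : IsClosed (cham α K) := by
  simp only [cham, Set.ofPred_forall]
  exact isClosed_biInter fun k _ => isClosed_le continuous_const (by fun_prop)

/-- A convex subset of `C_K` contained in no wall of `C_K` meets the interior of `C_K`. -/
theorem exists_forall_inner_pos {n : ℕ} {α : Fin n → V} {K : Set (Fin n)} {G : Set V}
    (hG : Convex ℝ G) (hne : G.Nonempty) (hGK : G ⊆ cham α K)
    (hwall : ∀ k ∈ K, ¬ G ⊆ hplane (α k)) : ∃ g ∈ G, ∀ k ∈ K, 0 < ⟪g, α k⟫ := by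
  suffices h : ∀ T : Finset (Fin n), ∃ g ∈ G, ∀ k ∈ T, k ∈ K → 0 < ⟪g, α k⟫ by
    obtain ⟨g, hg, h⟩ := h Finset.univ
    exact ⟨g, hg, fun k hk => h k (Finset.mem_univ k) hk⟩
  intro T
  induction T using Finset.induction_on with
  | empty => exact hne.imp fun g hg => ⟨hg, by simp⟩
  | insert j T _ ih =>
    obtain ⟨g, hg, h⟩ := ih
    by_cases hj : j ∈ K
    · obtain ⟨y, hy, hyj⟩ := Set.not_subset.1 (hwall j hj)
      have hyj' : 0 < ⟪y, α j⟫ := lt_of_le_of_ne (hGK hy j hj) (Ne.symm hyj)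
      refine ⟨(1 / 2 : ℝ) • g + (1 / 2 : ℝ) • y,
        hG hg hy (by norm_num) (by norm_num) (by norm_num), fun k hk hkK => ?_⟩
      rw [inner_add_left, real_inner_smul_left, real_inner_smul_left]
      have hgk := hGK hg k hkK
      have hyk := hGK hy k hkK
      rcases Finset.mem_insert.1 hk with rfl | hk
      · linarith
      · linarith [h k hk hkK]
    · refine ⟨g, hg, fun k hk hkK => ?_⟩
      rcases Finset.mem_insert.1 hk with rfl | hk
      · exact absurd hkK hj
      · exact h k hk hkK

/-- A facet of `P ∩ C_K` is cut out by a wall of `C_K` or by a facet of `P`. -/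
theorem IsFacet.inter_cham_cases [FiniteDimensional ℝ V] {n : ℕ} {P : Set V}
    (hP : Convex ℝ P) {α : Fin n → V} (hα : ∀ k, α k ≠ 0) {K : Set (Fin n)}
    (hint : (interior (P ∩ cham α K)).Nonempty) {G : Set V}
    (hG : IsFacet (P ∩ cham α K) G) (hne : G.Nonempty) :
    (∃ k ∈ K, G = P ∩ cham α K ∩ hplane (α k)) ∨ ∃ F, IsFacet P F ∧ G = F ∩ cham α K := by
  obtain ⟨hexp, hdim⟩ := hG
  have hGconv : Convex ℝ G := hexp.convex (hP.inter (convex_cham α K))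
  have hGsub : G ⊆ P ∩ cham α K := hexp.subset
  obtain ⟨f, hf⟩ := hexp hne
  have hmem : ∀ x, x ∈ G ↔ x ∈ P ∩ cham α K ∧ ∀ y ∈ P ∩ cham α K, f y ≤ f x := by
    intro x; rw [hf]; rfl
  have hconst : ∀ x ∈ G, ∀ y ∈ G, f x = f y := fun x hx y hy =>
    le_antisymm (((hmem y).1 hy).2 x (hGsub hx)) (((hmem x).1 hx).2 y (hGsub hy))
  rw [direction_affineSpan] at hdim
  by_cases hwall : ∃ k ∈ K, G ⊆ hplane (α k)
  · obtain ⟨k, hk, hGk⟩ := hwall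
    refine Or.inl ⟨k, hk, (Set.subset_inter hGsub hGk).antisymm ?_⟩
    rintro y ⟨hyQ, hyk⟩
    obtain ⟨g, hg⟩ := hne
    have hle : vectorSpan ℝ G ≤ LinearMap.ker (innerSL ℝ (α k)).toLinearMap :=
      vectorSpan_le_ker (c := 0) fun x hx => (real_inner_comm x (α k)).trans (hGk hx)
    have hne0 : (innerSL ℝ (α k)).toLinearMap ≠ 0 := fun h => hα k <| by
      simpa using LinearMap.congr_fun h (α k)
    have hker : Module.finrank ℝ (LinearMap.ker (innerSL ℝ (α k)).toLinearMap) + 1 =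
        Module.finrank ℝ V := Module.Dual.finrank_ker_add_one_of_ne_zero hne0
    have heq := Submodule.eq_of_le_of_finrank_eq hle (by omega)
    have hyg : y - g ∈ vectorSpan ℝ G := by
      have h1 : ⟪y, α k⟫ = 0 := hyk
      have h2 : ⟪g, α k⟫ = 0 := hGk hg
      rw [heq]
      simp [inner_sub_right, real_inner_comm, h1, h2]
    have hfyg : f y = f g := by
      have := vectorSpan_le_ker (f := f.toLinearMap) (fun x hx => hconst x hx g hg) hyg
      simpa [sub_eq_zero] using this
    exact (hmem y).2 ⟨hyQ, fun z hz => hfyg ▸ ((hmem g).1 hg).2 z hz⟩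
  · push Not at hwall
    right
    obtain ⟨g, hg, hgpos⟩ := exists_forall_inner_pos hGconv hne
      (hGsub.trans Set.inter_subset_right) hwall
    have hU : {x : V | ∀ k ∈ K, 0 < ⟪x, α k⟫} ∈ nhds g := by
      refine IsOpen.mem_nhds ?_ hgpos
      simp only [Set.ofPred_forall]
      exact (Set.toFinite K).isOpen_biInter fun i _ => isOpen_lt continuous_const (by fun_prop)
    have hloc : IsLocalMaxOn f P g := by
      filter_upwards [mem_nhdsWithin_of_mem_nhds hU, self_mem_nhdsWithin] with x hx hxP
      exact ((hmem g).1 hg).2 x ⟨hxP, fun k hk => (hx k hk).le⟩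
    have hmax := IsMaxOn.of_isLocalMaxOn_of_concaveOn (hGsub hg).1 hloc
      (f.toLinearMap.concaveOn hP)
    have hmax' : ∀ y ∈ P, f y ≤ f g := fun y hy => hmax hy
    set F : Set V := {x ∈ P | ∀ y ∈ P, f y ≤ f x} with hF
    have hGF : G = F ∩ cham α K := by
      ext x
      constructor
      · intro hx
        exact ⟨⟨(hGsub hx).1, fun y hy => hconst g hg x hx ▸ hmax' y hy⟩, (hGsub hx).2⟩
      · rintro ⟨hx, hxK⟩
        exact (hmem x).2 ⟨⟨hx.1, hxK⟩, fun y hy => hx.2 y hy.1⟩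
    have hf0 : f.toLinearMap ≠ 0 := by
      intro h0
      have hGQ : G = P ∩ cham α K := by
        ext x
        have : ∀ z, f z = 0 := fun z => LinearMap.congr_fun h0 z
        simp [hmem, this]
      have htop := affineSpan_eq_top_of_nonempty_interior (s := G)
        (hGQ ▸ hint.mono (interior_mono (subset_convexHull ℝ _)))
      rw [← direction_affineSpan, htop, AffineSubspace.direction_top, finrank_top] at hdim
      omega
    refine ⟨F, ⟨fun _ => ⟨f, rfl⟩, ?_⟩, hGF⟩
    have hker : Module.finrank ℝ (LinearMap.ker f.toLinearMap) + 1 =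
        Module.finrank ℝ V := Module.Dual.finrank_ker_add_one_of_ne_zero hf0
    have h1 := Submodule.finrank_mono (vectorSpan_le_ker (f := f.toLinearMap) (A := F) (c := f g)
      fun x hx => le_antisymm (hmax' x hx.1) (hx.2 g (hGsub hg).1))
    have h2 := Submodule.finrank_mono
      (vectorSpan_mono ℝ (hGF.trans_subset Set.inter_subset_left))
    rw [direction_affineSpan]
    omega

namespace PermSetup

variable {n : ℕ} (S : PermSetup V n)

/-- A nonempty intersection of maximal faces of `P`, each meeting `C_K`, meets `C_K` in a
point lying on every wall `H_{α_j}`, `j ∈ J ⊆ K`, that meets each of these faces. -/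
theorem exists_mem_cham_of_maximal_faces (hnd : S.Nondegenerate) {K J : Set (Fin n)}
    (hJ : J ⊆ K) {L : Set (V →L[ℝ] ℝ)} (hne : ∃ x ∈ S.P, ∀ f ∈ L, ∀ y ∈ S.P, f y ≤ f x)
    (hLK : ∀ f ∈ L, ∀ k ∈ K, 0 ≤ f (S.α k)) (hLJ : ∀ f ∈ L, ∀ j ∈ J, f (S.α j) = 0) :
    ∃ x ∈ S.P ∩ cham S.α K, (∀ f ∈ L, ∀ y ∈ S.P, f y ≤ f x) ∧ ∀ j ∈ J, ⟪x, S.α j⟫ = 0 := by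
  obtain ⟨l, hl⟩ := S.hΛ_ne
  have hlpos : ∀ i, 0 < ⟪S.α i, l⟫ := fun i => by
    rw [real_inner_comm]
    exact hnd l hl i
  set M : Set V := S.P ∩ {x | ∀ f ∈ L, ∀ y ∈ S.P, f y ≤ f x} with hM
  have hMc : IsCompact M := by
    refine S.isCompact_P.inter_right ?_
    simp only [Set.ofPred_forall]
    exact isClosed_biInter fun f _ => isClosed_biInter fun y _ =>
      isClosed_le continuous_const f.continuous
  have hcont : Continuous fun x : V => ⟪x, l⟫ := by fun_prop
  have hMK : (M ∩ cham S.α K).Nonempty := by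
    obtain ⟨x, hx, hmax⟩ := hMc.exists_isMaxOn hne hcont.continuousOn
    refine ⟨x, hx, fun k hk => ?_⟩
    by_contra! hneg
    have hc : 2 * ⟪x, S.α k⟫ / ⟪S.α k, S.α k⟫ < 0 :=
      div_neg_of_neg_of_pos (by linarith) (S.inner_α_self_pos k)
    have hrM : reflMap (S.α k) x ∈ M := by
      refine ⟨S.reflMap_mem_P hx.1 k, fun f hf y hy => (hx.2 f hf y hy).trans ?_⟩
      simp only [reflMap, map_sub, map_smul, smul_eq_mul]
      linarith [mul_nonpos_of_nonpos_of_nonneg hc.le (hLK f hf k hk)]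
    have h1 : ⟪reflMap (S.α k) x, l⟫ ≤ ⟪x, l⟫ := hmax hrM
    simp only [reflMap, inner_sub_left, real_inner_smul_left] at h1
    linarith [mul_neg_of_neg_of_pos hc (hlpos k)]
  obtain ⟨x, hx, hmin⟩ := (hMc.inter_right (isClosed_cham S.α K)).exists_isMinOn hMK
    hcont.continuousOn
  refine ⟨x, ⟨hx.1.1, hx.2⟩, hx.1.2, fun j hj => ?_⟩
  by_contra hj0
  have hjpos : 0 < ⟪x, S.α j⟫ := lt_of_le_of_ne (hx.2 j (hJ hj)) (Ne.symm hj0)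
  have hself := S.inner_α_self_pos j
  set c := ⟪x, S.α j⟫ / ⟪S.α j, S.α j⟫ with hc
  have hcpos : 0 < c := div_pos hjpos hself
  have hxP : x - c • S.α j ∈ S.P := by
    have h := S.convex_P hx.1.1 (S.reflMap_mem_P hx.1.1 j) (a := 1 / 2) (b := 1 / 2)
      (by norm_num) (by norm_num) (by norm_num)
    convert h using 1
    rw [reflMap, mul_div_assoc, ← hc]
    module
  have hxM : x - c • S.α j ∈ M ∩ cham S.α K := by
    refine ⟨⟨hxP, fun f hf y hy => ?_⟩, fun k hk => ?_⟩
    · simpa [hLJ f hf j hj] using hx.1.2 f hf y hy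
    · rw [inner_sub_left, real_inner_smul_left]
      by_cases hjk : j = k
      · subst hjk
        rw [hc, div_mul_cancel₀ _ hself.ne', sub_self]
      · linarith [hx.2 k hk, mul_nonpos_of_nonneg_of_nonpos hcpos.le (S.inner_α_nonpos hjk)]
  have h1 : ⟪x, l⟫ ≤ ⟪x - c • S.α j, l⟫ := hmin hxM
  rw [inner_sub_left, real_inner_smul_left] at h1
  linarith [mul_pos hcpos (hlpos j)]

end PermSetup

/-- Proposition 2.6(2): for nondegenerate `P`, if `P` is a flag polytope, then so is
the full-dimensional polytope `P ∩ C_K`. -/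
theorem statement_11 {V : Type*} [NormedAddCommGroup V] [InnerProductSpace ℝ V]
    [FiniteDimensional ℝ V] {n : ℕ} (S : PermSetup V n)
    (hfull : (interior S.P).Nonempty) (hnd : S.Nondegenerate) (K : Set (Fin n))
    (hflag : IsFlag S.P) :
    (interior (S.P ∩ cham S.α K)).Nonempty ∧ IsFlag (S.P ∩ cham S.α K) := by
  have hint := S.interior_inter_cham_nonempty hfull hnd K
  refine ⟨hint, fun 𝒢 _ hfac hpair => ?_⟩
  have hcases := fun G hG => (hfac G hG).inter_cham_cases S.convex_P S.α_ne_zero hint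
    (by simpa using hpair G hG G hG)
  set 𝓕 : Set (Set V) := {F | IsFacet S.P F ∧ F ∩ cham S.α K ∈ 𝒢} with h𝓕
  set J : Set (Fin n) := {j ∈ K | S.P ∩ cham S.α K ∩ hplane (S.α j) ∈ 𝒢} with hJ
  have hF_ne : ∀ F ∈ 𝓕, (F ∩ cham S.α K).Nonempty := fun F hF => by
    simpa using hpair _ hF.2 _ hF.2
  set L : Set (V →L[ℝ] ℝ) :=
    {f | {x ∈ S.P | ∀ y ∈ S.P, f y ≤ f x} ∈ 𝓕} with hL
  have hLne : ∃ x ∈ S.P, ∀ f ∈ L, ∀ y ∈ S.P, f y ≤ f x := by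
    rcases 𝓕.eq_empty_or_nonempty with h0 | hne
    · obtain ⟨l, hl⟩ := S.hΛ_ne
      exact ⟨l, S.subset_P hl, fun f hf => absurd hf (by simp [hL, h0])⟩
    · obtain ⟨x, hx⟩ := hflag 𝓕 hne (fun F hF => hF.1) fun F hF F' hF' =>
        (hpair _ hF.2 _ hF'.2).mono fun z hz => ⟨hz.1.1, hz.2.1⟩
      obtain ⟨F, hF⟩ := hne
      exact ⟨x, hF.1.1.subset (hx F hF), fun f hf => (hx _ hf).2⟩
  obtain ⟨x, hxQ, hxL, hxJ⟩ := S.exists_mem_cham_of_maximal_faces hnd (J := J)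
    (fun j hj => hj.1) hLne
    (fun f hf k hk => by
      obtain ⟨z, hz, hzK⟩ := hF_ne _ hf
      exact S.apply_α_nonneg_of_isMaxOn hnd hz.1 hz.2 (hzK k hk))
    (fun f hf j hj => by
      obtain ⟨z, hz, hzj⟩ := hpair _ hf.2 _ hj.2
      exact S.apply_α_eq_zero_of_isMaxOn hnd hz.1.1 hz.1.2 hzj.2)
  refine ⟨x, fun G hG => ?_⟩
  rcases hcases G hG with ⟨k, hk, rfl⟩ | ⟨F, hF, rfl⟩
  · exact ⟨hxQ, hxJ k ⟨hk, hG⟩⟩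
  · refine ⟨?_, hxQ.2⟩
    have hF' : F ∈ 𝓕 := ⟨hF, hG⟩
    obtain ⟨f, hf⟩ := hF.1 ((hF_ne F hF').mono Set.inter_subset_left)
    rw [hf]
    exact ⟨hxQ.1, hxL f (by rw [hL, Set.mem_ofPred_eq, ← hf]; exact hF')⟩
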